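/- For every f ∈ C_{0,c}^∞(ℝ⁺) and every t, the boundary trace of the Duhamel boundary forcing operator of order 0 recovers the boundary datum: L⁰f(t,0) = f(t). -/

import Mathlib

open MeasureTheory Complex Filter Set

noncomputable section

/-- One-dimensional Fourier transform `φ̂(ξ) = ∫ e^{-iξx} φ(x) dx`. -/
def FT (f : ℝ → ℂ) (ξ : ℝ) : ℂ :=
  ∫ x : ℝ, Complex.exp (-(Complex.I * ξ * x)) * f x

/-- The `Hˢ(ℝ)` Sobolev norm `‖(1+|ξ|²)^{s/2} φ̂‖_{L²}`. -/
def sobNorm (s : ℝ) (f : ℝ → ℂ) : ℝ :=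
  (∫ ξ : ℝ, (1 + ξ ^ 2) ^ s * ‖FT f ξ‖ ^ 2) ^ ((1 : ℝ) / 2)

/-- Membership in `Hˢ(ℝ)`. -/
def MemHs (s : ℝ) (f : ℝ → ℂ) : Prop :=
  Integrable (fun ξ : ℝ => (1 + ξ ^ 2) ^ s * ‖FT f ξ‖ ^ 2)

/-- Membership in `Hˢ(ℝ⁺)`: restriction of an `Hˢ(ℝ)` function to `(0,∞)`. -/
def MemHsHalf (s : ℝ) (f : ℝ → ℂ) : Prop :=
  ∃ F : ℝ → ℂ, MemHs s F ∧ ∀ x > 0, F x = f x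

/-- The `Hˢ(ℝ⁺)` norm: infimum of the norms of all extensions. -/
def sobNormHalf (s : ℝ) (f : ℝ → ℂ) : ℝ :=
  sInf {c : ℝ | ∃ F : ℝ → ℂ, MemHs s F ∧ (∀ x > 0, F x = f x) ∧ c = sobNorm s F}

/-- Membership in `H₀ˢ(ℝ⁺)`: extension vanishing on `(-∞,0)`. -/
def MemHsZero (s : ℝ) (f : ℝ → ℂ) : Prop :=
  ∃ F : ℝ → ℂ, MemHs s F ∧ (∀ x > 0, F x = f x) ∧ ∀ x < 0, F x = 0

/-- The `H₀ˢ(ℝ⁺)` norm. -/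
def sobNormZero (s : ℝ) (f : ℝ → ℂ) : ℝ :=
  sInf {c : ℝ | ∃ F : ℝ → ℂ,
    MemHs s F ∧ (∀ x > 0, F x = f x) ∧ (∀ x < 0, F x = 0) ∧ c = sobNorm s F}

/-- Membership in `Hˢ(0,T)`. -/
def MemHsInterval (s T : ℝ) (f : ℝ → ℂ) : Prop :=
  ∃ F : ℝ → ℂ, MemHs s F ∧ ∀ t ∈ Set.Ioo (0 : ℝ) T, F t = f t

/-- The `Hˢ(0,T)` norm. -/
def sobNormInterval (s T : ℝ) (f : ℝ → ℂ) : ℝ :=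
  sInf {c : ℝ | ∃ F : ℝ → ℂ,
    MemHs s F ∧ (∀ t ∈ Set.Ioo (0 : ℝ) T, F t = f t) ∧ c = sobNorm s F}

/-- Space-time Fourier transform `f̃(τ,ξ)` of `f(t,x)`. -/
def FT2 (f : ℝ → ℝ → ℂ) (τ ξ : ℝ) : ℂ :=
  ∫ t : ℝ, ∫ x : ℝ, Complex.exp (-(Complex.I * (ξ * x + τ * t))) * f t x

/-- Bourgain `X^{s,b}` norm associated with `i∂ₜu - ∂ₓ⁴u = 0`. -/
def XNorm (s b : ℝ) (f : ℝ → ℝ → ℂ) : ℝ :=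
  (∫ τ : ℝ, ∫ ξ : ℝ,
    (1 + ξ ^ 2) ^ s * (1 + (τ + ξ ^ 4) ^ 2) ^ b * ‖FT2 f τ ξ‖ ^ 2) ^ ((1 : ℝ) / 2)

/-- Membership in the Bourgain space `X^{s,b}`. -/
def MemX (s b : ℝ) (f : ℝ → ℝ → ℂ) : Prop :=
  Integrable (fun p : ℝ × ℝ =>
    (1 + p.2 ^ 2) ^ s * (1 + (p.1 + p.2 ^ 4) ^ 2) ^ b * ‖FT2 f p.1 p.2‖ ^ 2)

/-- Membership in the restricted space `X^{s,b}((0,T) × ℝ⁺)`. -/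
def MemXRestricted (s b T : ℝ) (u : ℝ → ℝ → ℂ) : Prop :=
  ∃ U : ℝ → ℝ → ℂ, MemX s b U ∧ ∀ t ∈ Set.Ioo (0 : ℝ) T, ∀ x > (0 : ℝ), U t x = u t x

/-- The group `e^{it∂ₓ⁴}φ(x) = (1/2π) ∫ e^{ixξ} e^{-itξ⁴} φ̂(ξ) dξ`. -/
def linGroup (t : ℝ) (φ : ℝ → ℂ) (x : ℝ) : ℂ :=
  (1 / (2 * Real.pi)) * ∫ ξ : ℝ, Complex.exp (Complex.I * x * ξ) *
    Complex.exp (-(Complex.I * t * ξ ^ 4)) * FT φ ξ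

/-- Duhamel inhomogeneous solution operator `Dw(t,x) = -i∫₀ᵗ e^{i(t-t')∂ₓ⁴} w(t') dt'`. -/
def Duhamel (w : ℝ → ℝ → ℂ) (t x : ℝ) : ℂ :=
  -Complex.I * ∫ t' in (0 : ℝ)..t, linGroup (t - t') (w t') x

/-- A smooth cut-off `ψ` with `0 ≤ ψ ≤ 1`, `ψ ≡ 1` on `[0,1]`, `ψ ≡ 0` for `|t| ≥ 2`. -/
def IsCutoff (ψ : ℝ → ℝ) : Prop :=
  ContDiff ℝ (⊤ : ℕ∞) ψ ∧ (∀ t, ψ t ∈ Set.Icc (0 : ℝ) 1) ∧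
    (∀ t ∈ Set.Icc (0 : ℝ) 1, ψ t = 1) ∧ ∀ t : ℝ, 2 ≤ |t| → ψ t = 0

/-- `C₀^∞(ℝ⁺)`: smooth functions on `ℝ` with support contained in `[0,∞)`. -/
def SmoothSupp (f : ℝ → ℂ) : Prop :=
  ContDiff ℝ (⊤ : ℕ∞) f ∧ ∀ x < (0 : ℝ), f x = 0

/-- `C₀,c^∞(ℝ⁺)`: smooth functions with compact support contained in `(0,∞)`. -/
def SmoothCpt (f : ℝ → ℂ) : Prop :=
  ContDiff ℝ (⊤ : ℕ∞) f ∧ HasCompactSupport f ∧ tsupport f ⊆ Set.Ioi 0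

/-- The Riemann-Liouville operator `I_α`, extended to all `α ∈ ℂ` by
`t₊^{α-1}/Γ(α) = ∂ₜᵏ (t₊^{α+k-1}/Γ(α+k))`. -/
def RL (α : ℂ) (f : ℝ → ℂ) (t : ℝ) : ℂ :=
  if 0 < α.re then
    (1 / Complex.Gamma α) * ∫ s in (0 : ℝ)..t, ((t - s : ℝ) : ℂ) ^ (α - 1) * f s
  else
    (1 / Complex.Gamma (α + (⌈-α.re⌉₊ + 1 : ℕ))) *
      ∫ s in (0 : ℝ)..t, ((t - s : ℝ) : ℂ) ^ (α + (⌈-α.re⌉₊ + 1 : ℕ) - 1) *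
        iteratedDeriv (⌈-α.re⌉₊ + 1) f s

/-- The oscillatory integral `B(x) = (1/2π) ∫ e^{ixξ} e^{-iξ⁴} dξ`, as the regularized
limit with factors `e^{-ε|ξ|}` as `ε → 0⁺`. -/
def Bker (x : ℝ) : ℂ :=
  limUnder (nhdsWithin (0 : ℝ) (Set.Ioi 0)) fun ε : ℝ =>
    (1 / (2 * Real.pi)) * ∫ ξ : ℝ, Complex.exp (Complex.I * x * ξ) *
      Complex.exp (-(Complex.I * ξ ^ 4)) * Complex.exp (-((ε * |ξ| : ℝ) : ℂ))

/-- `M = 1/(B(0)Γ(3/4))`. -/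
def Mconst : ℂ := 1 / (Bker 0 * Complex.Gamma (3 / 4))

/-- Duhamel boundary forcing operator of order `0`:
`L⁰f(t,x) = M ∫₀ᵗ B(x/(t-t')^{1/4}) (t-t')^{-1/4} I_{-3/4}f(t') dt'`. -/
def Lzero (f : ℝ → ℂ) (t x : ℝ) : ℂ :=
  Mconst * ∫ t' in (0 : ℝ)..t,
    Bker (x / (t - t') ^ ((1 : ℝ) / 4)) * (((t - t') ^ ((1 : ℝ) / 4) : ℝ) : ℂ)⁻¹ *
      RL (-(3 : ℂ) / 4) f t'

/-- The function `x ↦ x₋^μ = (-x)₊^μ`. -/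
def negPartPow (μ : ℂ) (x : ℝ) : ℂ := if x < 0 then ((-x : ℝ) : ℂ) ^ μ else 0

/-- Duhamel boundary forcing operator of order `λ` (for `Re λ > -4`):
`L^λ g(t,x) = [x₋^{λ-1}/Γ(λ) ∗ L⁰(I_{-λ/4}g)(t,·)](x)`, realized through the identity
`L^λ g(t,x) = iM x₋^{λ+3}/Γ(λ+4) I_{-3/4-λ/4}g(t)
  + i ∫ₓ^∞ (y-x)^{λ+3}/Γ(λ+4) L⁰(∂ₜ I_{-λ/4}g)(t,y) dy`. -/
def Llam (lam : ℂ) (g : ℝ → ℂ) (t x : ℝ) : ℂ :=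
  Complex.I * Mconst * (negPartPow (lam + 3) x / Complex.Gamma (lam + 4)) *
      RL (-(3 : ℂ) / 4 - lam / 4) g t
  + Complex.I * (1 / Complex.Gamma (lam + 4)) *
      ∫ y in Set.Ioi x, ((y - x : ℝ) : ℂ) ^ (lam + 3) *
        Lzero (RL (-lam / 4) (deriv g)) t y

/-- The direction `e^{-iπ/8}` of steepest descent of `e^{-iz⁴}`. -/
def descentDir : ℂ := Complex.exp (((-(Real.pi / 8) : ℝ) : ℂ) * Complex.I)

theorem descentDir_pow_four : descentDir ^ 4 = -Complex.I := by
  rw [descentDir, ← Complex.exp_nat_mul, ← Complex.exp_neg_pi_div_two_mul_I]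
  congr 1
  push_cast
  ring

theorem descentDir_re : descentDir.re = Real.cos (Real.pi / 8) := by
  rw [descentDir, Complex.exp_ofReal_mul_I_re, Real.cos_neg]

theorem descentDir_im : descentDir.im = -Real.sin (Real.pi / 8) := by
  rw [descentDir, Complex.exp_ofReal_mul_I_im, Real.sin_neg]

theorem descentDir_re_pos : 0 < descentDir.re := by
  rw [descentDir_re]
  exact Real.cos_pos_of_mem_Ioo ⟨by linarith [Real.pi_pos], by linarith [Real.pi_pos]⟩

theorem descentDir_im_nonpos : descentDir.im ≤ 0 := by
  rw [descentDir_im, neg_nonpos]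
  exact Real.sin_nonneg_of_nonneg_of_le_pi (by linarith [Real.pi_pos]) (by linarith [Real.pi_pos])

theorem neg_descentDir_re_le_im : -descentDir.re ≤ descentDir.im := by
  rw [descentDir_re, descentDir_im, neg_le_neg_iff, ← Real.cos_pi_div_two_sub]
  exact Real.cos_le_cos_of_nonneg_of_le_pi (by linarith [Real.pi_pos]) (by linarith [Real.pi_pos])
    (by linarith [Real.pi_pos])

theorem norm_descentDir : ‖descentDir‖ = 1 := Complex.norm_exp_ofReal_mul_I _

/-- In the sector `-π/4 ≤ arg z ≤ 0` the damped integrand decays like `e^{-ε Re z}`. -/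
theorem norm_exp_quartic_le {ε : ℝ} {z : ℂ} (h₁ : -z.re ≤ z.im) (h₂ : z.im ≤ 0) :
    ‖Complex.exp (-(Complex.I * z ^ 4) - ε * z)‖ ≤ Real.exp (-(ε * z.re)) := by
  rw [Complex.norm_exp, Real.exp_le_exp]
  have h : (-(Complex.I * z ^ 4) - ε * z).re
      = 4 * (z.re * z.im) * (z.re ^ 2 - z.im ^ 2) - ε * z.re := by
    simp [pow_succ]
    ring
  have h₃ : z.re * z.im ≤ 0 := mul_nonpos_of_nonneg_of_nonpos (by linarith) h₂
  have h₄ : 0 ≤ z.re ^ 2 - z.im ^ 2 := by nlinarith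
  rw [h]
  nlinarith [mul_nonneg (neg_nonneg.2 h₃) h₄]

theorem integrableOn_exp_quartic {ε : ℝ} (hε : 0 < ε) {w : ℂ} (hw : 0 < w.re)
    (h₁ : -w.re ≤ w.im) (h₂ : w.im ≤ 0) :
    IntegrableOn (fun x : ℝ => Complex.exp (-(Complex.I * (w * x) ^ 4) - ε * (w * x)))
      (Ioi 0) := by
  refine Integrable.mono' (exp_neg_integrableOn_Ioi 0 (mul_pos hε hw)) ?_ ?_
  · exact (Continuous.aestronglyMeasurable (by fun_prop))
  · refine (ae_restrict_iff' measurableSet_Ioi).2 (Eventually.of_forall fun x (hx : 0 < x) => ?_)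
    refine (norm_exp_quartic_le ?_ ?_).trans (le_of_eq ?_)
    · simp only [Complex.re_mul_ofReal, Complex.im_mul_ofReal]
      nlinarith
    · simp only [Complex.im_mul_ofReal]
      nlinarith
    · simp only [Complex.re_mul_ofReal]
      ring_nf

/-- Rotation of the contour from the positive real axis to the ray of steepest descent. -/
theorem integral_exp_quartic_rotate {ε : ℝ} (hε : 0 < ε) :
    ∫ x in Ioi (0 : ℝ), Complex.exp (-(Complex.I * (x : ℂ) ^ 4) - ε * x) =
      descentDir * ∫ x in Ioi (0 : ℝ),
        Complex.exp (-(Complex.I * (descentDir * x) ^ 4) - ε * (descentDir * x)) := by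
  set g : ℂ → ℂ := fun z => Complex.exp (-(Complex.I * z ^ 4) - ε * z) with hg
  obtain ⟨G, hG⟩ := (show Differentiable ℂ g by fun_prop).isExactOn_univ
  have primitive (w : ℂ) (R : ℝ) : ∫ x in (0 : ℝ)..R, w * g (w * x) = G (w * R) - G 0 := by
    rw [intervalIntegral.integral_eq_sub_of_hasDerivAt (f := fun x : ℝ => G (w * x))]
    · simp
    · intro x _
      have := (hG (w * x) (mem_univ _)).comp (x : ℂ) ((hasDerivAt_id (x : ℂ)).const_mul w)
      simpa [mul_comm, Function.comp_def] using this.comp_ofReal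
    · exact Continuous.intervalIntegrable (by fun_prop) _ _
  have lim (w : ℂ) (hw : 0 < w.re) (h₁ : -w.re ≤ w.im) (h₂ : w.im ≤ 0) :
      Tendsto (fun R : ℝ => G (w * R) - G 0) atTop
        (nhds (w * ∫ x in Ioi (0 : ℝ), g (w * x))) := by
    simp_rw [← primitive, ← integral_const_mul]
    exact intervalIntegral_tendsto_integral_Ioi 0
      ((integrableOn_exp_quartic hε hw h₁ h₂).const_mul w) tendsto_id
  have l₁ := lim 1 (by simp) (by simp) (by simp)
  have l₂ := lim descentDir descentDir_re_pos neg_descentDir_re_le_im descentDir_im_nonpos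
  simp only [one_mul] at l₁
  refine tendsto_nhds_unique l₁ ?_
  have arc : Tendsto (fun R : ℝ => G R - G (descentDir * R)) atTop (nhds 0) := by
    set c := descentDir.re with hc
    have decay : Tendsto (fun R : ℝ => 2 * (R ^ (1 : ℝ) * Real.exp (-(ε * c) * R))) atTop
        (nhds 0) := by
      simpa using (tendsto_rpow_mul_exp_neg_mul_atTop_nhds_zero 1 (ε * c)
        (mul_pos hε descentDir_re_pos)).const_mul 2
    refine squeeze_zero_norm' ?_ decay
    filter_upwards [eventually_ge_atTop 0] with R hR
    have hc1 : c ≤ 1 := (Complex.re_le_norm _).trans norm_descentDir.le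
    let S : Set ℂ := {z | R * c ≤ z.re} ∩ ({z | 0 ≤ z.re + z.im} ∩ {z | z.im ≤ 0})
    have hS : Convex ℝ S :=
      (convex_halfSpace_ge Complex.reLm.isLinear _).inter
        ((convex_halfSpace_ge (Complex.reLm + Complex.imLm).isLinear _).inter
          (convex_halfSpace_le Complex.imLm.isLinear _))
    have hmem₁ : (R : ℂ) ∈ S := by
      refine ⟨?_, ?_, ?_⟩ <;> simp only [mem_ofPred_eq, Complex.ofReal_re, Complex.ofReal_im] <;>
        nlinarith
    have hmem₂ : descentDir * R ∈ S := by
      refine ⟨?_, ?_, ?_⟩ <;>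
        simp only [mem_ofPred_eq, Complex.re_mul_ofReal, Complex.im_mul_ofReal] <;>
        nlinarith [neg_descentDir_re_le_im, descentDir_im_nonpos]
    have key := hS.norm_image_sub_le_of_norm_hasDerivWithin_le (f := G) (f' := g)
      (C := Real.exp (-(ε * c) * R)) (fun z _ => (hG z (mem_univ _)).hasDerivWithinAt)
      (fun z hz => (norm_exp_quartic_le (by linarith [hz.2.1.out]) hz.2.2).trans
        (Real.exp_le_exp.2 (by nlinarith [hz.1.out]))) hmem₂ hmem₁
    refine key.trans ?_
    have hn : ‖(R : ℂ) - descentDir * R‖ ≤ 2 * R := by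
      refine (norm_sub_le _ _).trans ?_
      rw [norm_mul, norm_descentDir, Complex.norm_real, Real.norm_of_nonneg hR]
      linarith
    rw [Real.rpow_one]
    nlinarith [Real.exp_pos (-(ε * c) * R)]
  have := l₂.add arc
  rw [add_zero] at this
  refine this.congr fun R => ?_
  ring

theorem integral_quartic_eq_two_mul {ε : ℝ} (hε : 0 < ε) :
    ∫ ξ : ℝ, Complex.exp (-(Complex.I * (ξ : ℂ) ^ 4)) * Complex.exp (-((ε * |ξ| : ℝ) : ℂ)) =
      2 * ∫ x in Ioi (0 : ℝ), Complex.exp (-(Complex.I * (x : ℂ) ^ 4) - ε * x) := by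
  have int_pos : IntegrableOn
      (fun x : ℝ => Complex.exp (-(Complex.I * (x : ℂ) ^ 4) - ε * x)) (Ioi 0) := by
    simpa using integrableOn_exp_quartic hε (w := 1) (by simp) (by simp) (by simp)
  set h : ℝ → ℂ := fun ξ =>
    Complex.exp (-(Complex.I * (ξ : ℂ) ^ 4)) * Complex.exp (-((ε * |ξ| : ℝ) : ℂ)) with hh
  have h_pos : EqOn h (fun x : ℝ => Complex.exp (-(Complex.I * (x : ℂ) ^ 4) - ε * x))
      (Ioi 0) := fun x (hx : 0 < x) => by
    simp only [hh]
    rw [← Complex.exp_add, abs_of_pos hx]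
    push_cast
    ring_nf
  have h_even (x : ℝ) : h (-x) = h x := by
    simp [hh, Even.neg_pow (show Even 4 by decide)]
  have h_int : IntegrableOn h (Ioi 0) := int_pos.congr_fun h_pos.symm measurableSet_Ioi
  have h_int' : IntegrableOn h (Iic 0) := by
    have := IntegrableOn.comp_neg_Iic (f := h) (c := 0) (μ := volume)
      (by rwa [neg_zero, integrableOn_Ici_iff_integrableOn_Ioi])
    simpa [h_even] using this
  rw [← intervalIntegral.integral_Iic_add_Ioi h_int' h_int]
  have : ∫ x in Iic (0 : ℝ), h x = ∫ x in Ioi (0 : ℝ), h x := by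
    have := integral_comp_neg_Iic (0 : ℝ) h
    simpa [h_even] using this
  rw [this, setIntegral_congr_fun measurableSet_Ioi h_pos]
  ring

theorem integrableOn_exp_neg_pow_four :
    IntegrableOn (fun x : ℝ => Real.exp (-x ^ 4)) (Ioi 0) := by
  simpa using integrableOn_rpow_mul_exp_neg_rpow (p := 4) (s := 0) (by norm_num) (by norm_num)

theorem tendsto_integral_descent :
    Tendsto (fun ε : ℝ => ∫ x in Ioi (0 : ℝ),
        Complex.exp (-(Complex.I * (descentDir * x) ^ 4) - ε * (descentDir * x)))
      (nhdsWithin 0 (Ioi 0)) (nhds (Real.Gamma (1 / 4 + 1) : ℂ)) := by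
  have hlim : ∫ x in Ioi (0 : ℝ), Complex.exp (-(x : ℂ) ^ 4) = Real.Gamma (1 / 4 + 1) := by
    rw [← _root_.integral_exp_neg_rpow (p := 4) (by norm_num), ← integral_complex_ofReal]
    refine setIntegral_congr_fun measurableSet_Ioi fun x _ => ?_
    norm_cast
  rw [← hlim]
  have hexp (ε x : ℝ) : Complex.exp (-(Complex.I * (descentDir * x) ^ 4) - ε * (descentDir * x))
      = Complex.exp (-(x : ℂ) ^ 4 - ε * (descentDir * x)) := by
    rw [mul_pow, descentDir_pow_four]
    congr 2
    linear_combination (x : ℂ) ^ 4 * Complex.I_mul_I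
  simp_rw [hexp]
  refine tendsto_integral_filter_of_dominated_convergence (fun x : ℝ => Real.exp (-x ^ 4))
    ?_ ?_ integrableOn_exp_neg_pow_four ?_
  · exact Eventually.of_forall fun ε => Continuous.aestronglyMeasurable (by fun_prop)
  · filter_upwards [self_mem_nhdsWithin] with ε hε
    refine (ae_restrict_iff' measurableSet_Ioi).2 (Eventually.of_forall fun x (hx : 0 < x) => ?_)
    rw [Complex.norm_exp, Real.exp_le_exp]
    have : (-(x : ℂ) ^ 4 - ε * (descentDir * x)).re = -x ^ 4 - ε * (descentDir.re * x) := by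
      rw [Complex.sub_re, Complex.re_ofReal_mul, Complex.re_mul_ofReal]
      norm_cast
    rw [this]
    have := mul_pos (show 0 < ε from hε) (mul_pos descentDir_re_pos hx)
    linarith
  · refine Eventually.of_forall fun x => ?_
    have : Continuous fun ε : ℝ => Complex.exp (-(x : ℂ) ^ 4 - ε * (descentDir * x)) := by
      fun_prop
    simpa using (this.tendsto 0).mono_left nhdsWithin_le_nhds

theorem Bker_zero :
    Bker 0 = (1 / (2 * Real.pi)) * (2 * (descentDir * (Real.Gamma (1 / 4 + 1) : ℂ))) := by
  refine Tendsto.limUnder_eq ?_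
  refine Tendsto.congr' ?_
    (((tendsto_integral_descent.const_mul descentDir).const_mul 2).const_mul _)
  filter_upwards [self_mem_nhdsWithin] with ε hε
  rw [← integral_exp_quartic_rotate hε, ← integral_quartic_eq_two_mul hε]
  simp

theorem Bker_zero_ne_zero : Bker 0 ≠ 0 := by
  rw [Bker_zero]
  have h₁ : (Real.Gamma (1 / 4 + 1) : ℂ) ≠ 0 :=
    Complex.ofReal_ne_zero.2 (Real.Gamma_pos_of_pos (by norm_num)).ne'
  exact mul_ne_zero (by simp [Real.pi_ne_zero])
    (mul_ne_zero two_ne_zero (mul_ne_zero (Complex.exp_ne_zero _) h₁))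

/-- The Beta integral over an arbitrary interval. -/
theorem integral_cpow_mul_cpow {a b : ℂ} (ha : 0 < a.re) (hb : 0 < b.re) {s t : ℝ} (hst : s < t) :
    Complex.Gamma (a + b) *
        ∫ u in s..t, ((t - u : ℝ) : ℂ) ^ (a - 1) * ((u - s : ℝ) : ℂ) ^ (b - 1) =
      Complex.Gamma a * Complex.Gamma b * ((t - s : ℝ) : ℂ) ^ (a + b - 1) := by
  have h := betaIntegral_scaled b a (sub_pos.2 hst)
  have shift := intervalIntegral.integral_comp_sub_right (a := s) (b := t)
    (fun x : ℝ => (x : ℂ) ^ (b - 1) * (((t - s : ℝ) : ℂ) - x) ^ (a - 1)) s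
  rw [sub_self, h] at shift
  have : ∫ u in s..t, ((t - u : ℝ) : ℂ) ^ (a - 1) * ((u - s : ℝ) : ℂ) ^ (b - 1) =
      ((t - s : ℝ) : ℂ) ^ (b + a - 1) * betaIntegral b a := by
    rw [← shift]
    refine intervalIntegral.integral_congr fun u _ => ?_
    rw [mul_comm]
    congr 2
    push_cast
    ring
  rw [this, mul_comm (Complex.Gamma a), Gamma_mul_Gamma_eq_betaIntegral hb ha, add_comm a b]
  ring

theorem intervalIntegrable_sub_cpow {a : ℂ} (ha : 0 < a.re) (t : ℝ) :
    IntervalIntegrable (fun u : ℝ => ((t - u : ℝ) : ℂ) ^ (a - 1)) volume 0 t := by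
  have h : IntervalIntegrable (fun x : ℝ => (x : ℂ) ^ (a - 1)) volume 0 t :=
    intervalIntegral.intervalIntegrable_cpow' (by simpa using ha)
  simpa using (h.comp_sub_left t).symm

/-- The semigroup property of Riemann-Liouville integrals, cleared of denominators. -/
theorem integral_cpow_mul_integral_cpow {a b : ℂ} (ha : 0 < a.re) (hb : 1 < b.re) {g : ℝ → ℂ}
    (hg : Continuous g) {t : ℝ} (ht : 0 ≤ t) :
    Complex.Gamma (a + b) * ∫ u in (0 : ℝ)..t, ((t - u : ℝ) : ℂ) ^ (a - 1) *
        ∫ s in (0 : ℝ)..u, ((u - s : ℝ) : ℂ) ^ (b - 1) * g s =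
      Complex.Gamma a * Complex.Gamma b *
        ∫ s in (0 : ℝ)..t, ((t - s : ℝ) : ℂ) ^ (a + b - 1) * g s := by
  have hb1 : b - 1 ≠ 0 := fun h => by
    rw [sub_eq_zero.1 h] at hb
    simp at hb
  set k : ℝ → ℂ := (Ioi 0).indicator fun x : ℝ => (x : ℂ) ^ (b - 1) with hk
  have k_of_nonneg {x : ℝ} (hx : 0 ≤ x) : k x = (x : ℂ) ^ (b - 1) := by
    rcases hx.eq_or_lt with rfl | hx
    · simp [hk, hb1]
    · exact indicator_of_mem (mem_Ioi.2 hx) _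
  have k_of_nonpos {x : ℝ} (hx : x ≤ 0) : k x = 0 :=
    indicator_of_notMem (notMem_Ioi.2 hx) _
  have k_meas : Measurable k :=
    Measurable.indicator (by fun_prop) measurableSet_Ioi
  have k_bound {x : ℝ} (hx : x ≤ t) : ‖k x‖ ≤ t ^ (b.re - 1) := by
    rcases le_or_gt x 0 with h | h
    · rw [k_of_nonpos h, norm_zero]
      exact Real.rpow_nonneg ht _
    · rw [k_of_nonneg h.le, Complex.norm_cpow_eq_rpow_re_of_pos h]
      exact Real.rpow_le_rpow h.le hx (by simpa using hb.le)
  have inner_left {u : ℝ} (hu : u ∈ Ioc 0 t) :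
      ∫ s in (0 : ℝ)..u, ((u - s : ℝ) : ℂ) ^ (b - 1) * g s = ∫ s in Ioc 0 t, k (u - s) * g s := by
    rw [intervalIntegral.integral_of_le hu.1.le]
    refine Eq.trans ?_ (setIntegral_eq_of_subset_of_forall_sdiff_eq_zero measurableSet_Ioc
      (Ioc_subset_Ioc_right hu.2) ?_).symm
    · refine setIntegral_congr_fun measurableSet_Ioc fun s hs => ?_
      simp only [k_of_nonneg (sub_nonneg.2 hs.2)]
    · intro s hs
      have : u < s := by
        by_contra! h
        exact hs.2 ⟨hs.1.1, h⟩
      rw [k_of_nonpos (by linarith), zero_mul]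
  have inner_right {s : ℝ} (hs : s ∈ Ioc 0 t) :
      ∫ u in Ioc 0 t, ((t - u : ℝ) : ℂ) ^ (a - 1) * k (u - s) =
        ∫ u in s..t, ((t - u : ℝ) : ℂ) ^ (a - 1) * ((u - s : ℝ) : ℂ) ^ (b - 1) := by
    rw [intervalIntegral.integral_of_le hs.2,
      setIntegral_eq_of_subset_of_forall_sdiff_eq_zero measurableSet_Ioc
        (Ioc_subset_Ioc_left hs.1.le)]
    · refine setIntegral_congr_fun measurableSet_Ioc fun u hu => ?_
      simp only [k_of_nonneg (sub_nonneg.2 hu.1.le)]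
    · intro u hu
      have : u ≤ s := by
        by_contra! h
        exact hu.2 ⟨h, hu.1.2⟩
      rw [k_of_nonpos (by linarith), mul_zero]
  have integrable : Integrable
      (Function.uncurry fun u s : ℝ => ((t - u : ℝ) : ℂ) ^ (a - 1) * (k (u - s) * g s))
      ((volume.restrict (Ioc 0 t)).prod (volume.restrict (Ioc 0 t))) := by
    have h := ((intervalIntegrable_iff_integrableOn_Ioc_of_le ht).1
      (intervalIntegrable_sub_cpow ha t)).integrable.mul_prod
      ((intervalIntegrable_iff_integrableOn_Ioc_of_le ht).1
        (hg.intervalIntegrable (μ := volume) 0 t)).integrable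
    refine (h.bdd_mul (f := fun z : ℝ × ℝ => k (z.1 - z.2)) (c := t ^ (b.re - 1))
      (k_meas.comp (measurable_fst.sub measurable_snd)).aestronglyMeasurable ?_).congr
        (Eventually.of_forall fun z => ?_)
    · rw [Measure.prod_restrict]
      refine (ae_restrict_iff' (measurableSet_Ioc.prod measurableSet_Ioc)).2
        (Eventually.of_forall fun z hz => k_bound ?_)
      linarith [hz.1.2, hz.2.1]
    · simp only [Function.uncurry]
      ring
  have swap : ∫ u in (0 : ℝ)..t, ((t - u : ℝ) : ℂ) ^ (a - 1) *
        ∫ s in (0 : ℝ)..u, ((u - s : ℝ) : ℂ) ^ (b - 1) * g s =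
      ∫ s in (0 : ℝ)..t, (∫ u in s..t, ((t - u : ℝ) : ℂ) ^ (a - 1) *
        ((u - s : ℝ) : ℂ) ^ (b - 1)) * g s := by
    rw [intervalIntegral.integral_of_le ht, intervalIntegral.integral_of_le ht]
    calc
      _ = ∫ u in Ioc 0 t, ∫ s in Ioc 0 t, ((t - u : ℝ) : ℂ) ^ (a - 1) * (k (u - s) * g s) := by
        refine setIntegral_congr_fun measurableSet_Ioc fun u hu => ?_
        simp only [inner_left hu, integral_const_mul]
      _ = ∫ s in Ioc 0 t, ∫ u in Ioc 0 t, ((t - u : ℝ) : ℂ) ^ (a - 1) * (k (u - s) * g s) :=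
        integral_integral_swap integrable
      _ = _ := by
        refine setIntegral_congr_fun measurableSet_Ioc fun s hs => ?_
        simp only [← inner_right hs, ← integral_mul_const, mul_assoc]
  rw [swap, ← intervalIntegral.integral_const_mul, ← intervalIntegral.integral_const_mul]
  refine intervalIntegral.integral_congr_ae ?_
  have hne : ∀ᵐ s : ℝ, s ≠ t := by simp [ae_iff, measure_singleton]
  filter_upwards [hne] with s hs hmem
  rw [uIoc_of_le ht] at hmem
  rw [← mul_assoc, integral_cpow_mul_cpow ha (by linarith) (lt_of_le_of_ne hmem.2 hs), mul_assoc]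

theorem integral_sub_mul_iteratedDeriv_two {f : ℝ → ℂ} (hf : ContDiff ℝ 2 f) (h₀ : f 0 = 0)
    (h₁ : deriv f 0 = 0) (t : ℝ) :
    ∫ s in (0 : ℝ)..t, ((t - s : ℝ) : ℂ) * iteratedDeriv 2 f s = f t := by
  have hd (s : ℝ) : HasDerivAt f (deriv f s) s :=
    (hf.differentiable (by norm_num) s).hasDerivAt
  have hdd (s : ℝ) : HasDerivAt (deriv f) (iteratedDeriv 2 f s) s := by
    have := (hf.differentiable_iteratedDeriv 1 (by norm_num) s).hasDerivAt
    rwa [← iteratedDeriv_succ, iteratedDeriv_one] at this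
  have hsub (s : ℝ) : HasDerivAt (fun s : ℝ => ((t - s : ℝ) : ℂ)) (-1) s := by
    simpa using ((hasDerivAt_id s).const_sub t).ofReal_comp
  rw [intervalIntegral.integral_eq_sub_of_hasDerivAt
    (f := fun s : ℝ => ((t - s : ℝ) : ℂ) * deriv f s + f s)]
  · simp [h₀, h₁]
  · intro s _
    refine (((hsub s).mul (hdd s)).add (hd s)).congr_deriv ?_
    ring
  · have := hf.continuous_iteratedDeriv 2 le_rfl
    exact Continuous.intervalIntegrable (by fun_prop) _ _

theorem RL_neg_three_quarters (f : ℝ → ℂ) (t : ℝ) :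
    RL (-(3 : ℂ) / 4) f t = (1 / Complex.Gamma (5 / 4)) *
      ∫ s in (0 : ℝ)..t, ((t - s : ℝ) : ℂ) ^ ((5 : ℂ) / 4 - 1) * iteratedDeriv 2 f s := by
  have hre : (-(3 : ℂ) / 4).re = -(3 / 4) := by norm_num
  have hceil : ⌈-(-(3 / 4) : ℝ)⌉₊ + 1 = 2 := by
    rw [Nat.add_right_cancel_iff, Nat.ceil_eq_iff one_ne_zero]
    norm_num
  have hα : -(3 : ℂ) / 4 + (2 : ℕ) = 5 / 4 := by norm_num
  rw [RL, hre, hceil, hα, if_neg (by norm_num)]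

theorem RL_neg_three_quarters_of_nonpos {f : ℝ → ℂ} (hf : ∀ s ≤ 0, iteratedDeriv 2 f s = 0)
    {t : ℝ} (ht : t ≤ 0) : RL (-(3 : ℂ) / 4) f t = 0 := by
  rw [RL_neg_three_quarters, intervalIntegral.integral_congr (g := fun _ => 0)]
  · simp
  · intro s hs
    rw [uIcc_of_ge ht] at hs
    simp [hf s hs.2]

theorem ofReal_rpow_inv {x : ℝ} (hx : 0 ≤ x) :
    ((x ^ ((1 : ℝ) / 4) : ℝ) : ℂ)⁻¹ = (x : ℂ) ^ ((3 : ℂ) / 4 - 1) := by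
  rw [Complex.ofReal_cpow hx, ← Complex.cpow_neg]
  congr 1
  push_cast
  norm_num

/-- the boundary trace of the Duhamel boundary forcing operator of order `0`
recovers the boundary datum: `L⁰f(t,0) = f(t)`. -/
theorem Lzero_trace (f : ℝ → ℂ) (hf : SmoothCpt f) (t : ℝ) : Lzero f t 0 = f t := by
  obtain ⟨hsmooth, -, hsupp⟩ := hf
  have hf2 : ContDiff ℝ 2 f := by exact_mod_cast contDiff_infty.1 hsmooth 2
  have hnot {s : ℝ} (hs : s ≤ 0) : s ∉ tsupport f := fun h => not_lt.2 hs (hsupp h)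
  have hzero {s : ℝ} (hs : s ≤ 0) : f s = 0 := image_eq_zero_of_notMem_tsupport (hnot hs)
  have hderiv : deriv f 0 = 0 :=
    image_eq_zero_of_notMem_tsupport fun h => hnot le_rfl (tsupport_deriv_subset h)
  have hiter : ∀ s ≤ 0, iteratedDeriv 2 f s = 0 := fun s hs => by
    rw [iteratedDeriv_succ, iteratedDeriv_one]
    exact image_eq_zero_of_notMem_tsupport fun h =>
      hnot hs (tsupport_deriv_subset (tsupport_deriv_subset h))
  rcases le_or_gt t 0 with ht | ht
  · rw [Lzero, intervalIntegral.integral_congr (g := fun _ => 0)]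
    · simp [hzero ht]
    · intro s hs
      rw [uIcc_of_ge ht] at hs
      simp [RL_neg_three_quarters_of_nonpos hiter hs.2]
  · have hΓ₁ : Complex.Gamma (3 / 4) ≠ 0 := Complex.Gamma_ne_zero_of_re_pos (by norm_num)
    have hΓ₂ : Complex.Gamma (5 / 4) ≠ 0 := Complex.Gamma_ne_zero_of_re_pos (by norm_num)
    have semigroup := integral_cpow_mul_integral_cpow (a := 3 / 4) (b := 5 / 4) (by norm_num)
      (by norm_num) (hf2.continuous_iteratedDeriv 2 le_rfl) ht.le
    have hsum : (3 / 4 + 5 / 4 : ℂ) = 2 := by norm_num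
    have hone : (2 - 1 : ℂ) = 1 := by norm_num
    simp only [hsum, hone, Complex.Gamma_ofNat_eq_factorial, Complex.cpow_one,
      integral_sub_mul_iteratedDeriv_two hf2 (hzero le_rfl) hderiv] at semigroup
    have integrand : ∫ t' in (0 : ℝ)..t, Bker (0 / (t - t') ^ ((1 : ℝ) / 4)) *
          (((t - t') ^ ((1 : ℝ) / 4) : ℝ) : ℂ)⁻¹ * RL (-(3 : ℂ) / 4) f t' =
        (Bker 0 / Complex.Gamma (5 / 4)) * ∫ u in (0 : ℝ)..t,
          ((t - u : ℝ) : ℂ) ^ ((3 : ℂ) / 4 - 1) * ∫ s in (0 : ℝ)..u,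
            ((u - s : ℝ) : ℂ) ^ ((5 : ℂ) / 4 - 1) * iteratedDeriv 2 f s := by
      rw [← intervalIntegral.integral_const_mul]
      refine intervalIntegral.integral_congr fun u hu => ?_
      rw [uIcc_of_le ht.le] at hu
      simp only [zero_div, RL_neg_three_quarters, ofReal_rpow_inv (sub_nonneg.2 hu.2)]
      ring
    have hB := Bker_zero_ne_zero
    norm_num at semigroup
    rw [Lzero, integrand, Mconst]
    norm_num
    rw [semigroup]
    field_simp
end
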